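/- Let n be a positive integer, γ > 0, μ > 0, and let C̄, T ∈ S_n. Let λ = (λ₁,…,λₙ) ∈ ℝⁿ and let U be an orthogonal matrix with C̄ + γT = U Diag(λ) Uᵀ. Consider the function on S_n defined by C ↦ γ(−log det(C) − tr(TC) + μ tr(C)) + ½‖C − C̄‖_F² for C positive definite, and +∞ otherwise. This function has a unique minimizer over S_n, equal to U Diag((½(λᵢ − γμ + √((λᵢ − γμ)² + 4γ)))₁≤ᵢ≤ₙ) Uᵀ (note that for a positive definite symmetric matrix C, μ tr(C) equals μ times the nuclear norm of C). -/

import Mathlib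

open Matrix

noncomputable section

open scoped Classical

/-- A real matrix is orthogonal. -/
def IsOrth {n : ℕ} (U : Matrix (Fin n) (Fin n) ℝ) : Prop := Uᵀ * U = 1

/-- Squared Frobenius norm. -/
def frobSq {n : ℕ} (A : Matrix (Fin n) (Fin n) ℝ) : ℝ := ∑ i, ∑ j, (A i j) ^ 2

/-- The objective `C ↦ γ(−log det C − tr(TC) + μ tr C) + ½‖C − C̄‖_F²` for `C` positive definite,
`+∞` otherwise. -/
def logdetProxObj {n : ℕ} (γ μ : ℝ) (T Cbar C : Matrix (Fin n) (Fin n) ℝ) : EReal :=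
  if C.PosDef then
    ((γ * (-Real.log C.det - (T * C).trace + μ * C.trace) + frobSq (C - Cbar) / 2 : ℝ) : EReal)
  else ⊤

theorem aux_logdet {n : ℕ} (M : Matrix (Fin n) (Fin n) ℝ) (hM : M.PosDef) :
    Real.log M.det ≤ M.trace - n := by
  have h1 := hM.isHermitian.det_eq_prod_eigenvalues
  have h2 := hM.isHermitian.trace_eq_sum_eigenvalues
  simp only [RCLike.ofReal_real_eq_id, id] at h1 h2
  rw [h1, h2, Real.log_prod (fun i _ => (hM.eigenvalues_pos i).ne')]
  calc _ ≤ ∑ i, (hM.isHermitian.eigenvalues i - 1) :=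
        Finset.sum_le_sum fun i _ => Real.log_le_sub_one_of_pos (hM.eigenvalues_pos i)
    _ = _ := by simp [Finset.sum_sub_distrib]

theorem aux_frob {n : ℕ} (C B P : Matrix (Fin n) (Fin n) ℝ) :
    frobSq (C - B) = frobSq (C - P) + 2 * ((P - B)ᵀ * (C - P)).trace + frobSq (P - B) := by
  have : ((P - B)ᵀ * (C - P)).trace = ∑ i, ∑ j, (P - B) i j * (C - P) i j := by
    simp only [Matrix.trace, Matrix.diag, Matrix.mul_apply, Matrix.transpose_apply]
    exact Finset.sum_comm
  rw [this]
  simp only [frobSq, Finset.mul_sum, ← Finset.sum_add_distrib, Matrix.sub_apply]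
  refine Finset.sum_congr rfl fun i _ => Finset.sum_congr rfl fun j _ => ?_
  ring

theorem aux_frob_nonneg {n : ℕ} (A : Matrix (Fin n) (Fin n) ℝ) : 0 ≤ frobSq A :=
  Finset.sum_nonneg fun _ _ => Finset.sum_nonneg fun _ _ => sq_nonneg _

theorem aux_frob_zero {n : ℕ} (A : Matrix (Fin n) (Fin n) ℝ) (h : frobSq A ≤ 0) : A = 0 := by
  have h0 : frobSq A = 0 := le_antisymm h (aux_frob_nonneg A)
  have h1 := (Finset.sum_eq_zero_iff_of_nonneg
    (fun i _ => Finset.sum_nonneg fun j _ => sq_nonneg (A i j))).mp h0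
  ext i j
  have h2 := (Finset.sum_eq_zero_iff_of_nonneg (fun j _ => sq_nonneg (A i j))).mp
    (h1 i (Finset.mem_univ _)) j (Finset.mem_univ _)
  exact pow_eq_zero_iff (two_ne_zero) |>.mp h2

theorem aux_posdef {n : ℕ} (U : Matrix (Fin n) (Fin n) ℝ) (hU : IsOrth U) (d : Fin n → ℝ)
    (hd : ∀ i, 0 < d i) : (U * Matrix.diagonal d * Uᵀ).PosDef := by
  have h : (Matrix.diagonal d).PosDef := Matrix.PosDef.diagonal hd
  have hu : IsUnit U := IsUnit.of_mul_eq_one_right _ hU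
  have := h.mul_mul_conjTranspose_same (B := U) (Matrix.vecMul_injective_of_isUnit hu)
  rwa [Matrix.conjTranspose_eq_transpose_of_trivial] at this

theorem aux_log {n : ℕ} (U : Matrix (Fin n) (Fin n) ℝ) (hU : IsOrth U) (d : Fin n → ℝ)
    (hd : ∀ i, 0 < d i) (C : Matrix (Fin n) (Fin n) ℝ) (hC : C.PosDef) :
    Real.log C.det - Real.log (U * Matrix.diagonal d * Uᵀ).det ≤
      ((U * Matrix.diagonal (fun i => (d i)⁻¹) * Uᵀ) * C).trace - n := by
  set P := U * Matrix.diagonal d * Uᵀ with hP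
  set s : Matrix (Fin n) (Fin n) ℝ := Matrix.diagonal (fun i => (Real.sqrt (d i))⁻¹) with hs
  have hUU : U * Uᵀ = 1 := mul_eq_one_comm.mp hU
  have hss : s * s = Matrix.diagonal (fun i => (d i)⁻¹) := by
    rw [hs, Matrix.diagonal_mul_diagonal]
    congr 1; ext i
    rw [← mul_inv, Real.mul_self_sqrt (hd i).le]
  have hst : sᵀ = s := Matrix.diagonal_transpose _
  have hsu : IsUnit s := by
    rw [Matrix.isUnit_iff_isUnit_det, hs, Matrix.det_diagonal, isUnit_iff_ne_zero]
    exact Finset.prod_ne_zero_iff.mpr fun i _ => inv_ne_zero (Real.sqrt_pos.mpr (hd i)).ne'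
  have hUtu : IsUnit Uᵀ := IsUnit.of_mul_eq_one_right _ hUU
  have hM := hC.mul_mul_conjTranspose_same (B := s * Uᵀ)
    (Matrix.vecMul_injective_of_isUnit (hsu.mul hUtu))
  rw [Matrix.conjTranspose_eq_transpose_of_trivial, Matrix.transpose_mul,
    Matrix.transpose_transpose, hst] at hM
  have h := aux_logdet _ hM
  have htr : (s * Uᵀ * C * (U * s)).trace =
      ((U * Matrix.diagonal (fun i => (d i)⁻¹) * Uᵀ) * C).trace := by
    rw [Matrix.trace_mul_comm, ← hss]
    simp only [Matrix.mul_assoc]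
  have hPpos : 0 < P.det := (aux_posdef U hU d hd).det_pos
  have hdU : U.det * U.det = 1 := by
    have := congrArg Matrix.det hU
    simpa using this
  have hdet : (s * Uᵀ * C * (U * s)).det * P.det = C.det := by
    have h1 : (s * s).det * (Matrix.diagonal d).det = 1 := by
      rw [← Matrix.det_mul, hss, Matrix.diagonal_mul_diagonal]
      simp [fun i => inv_mul_cancel₀ (hd i).ne']
    rw [Matrix.det_mul] at h1
    simp only [hP, Matrix.det_mul, Matrix.det_transpose]
    linear_combination (C.det * (U.det * U.det) ^ 2) * h1 + C.det * (U.det * U.det + 1) * hdU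
  rw [htr] at h
  have h2 := Real.log_mul hM.det_pos.ne' hPpos.ne'
  rw [hdet] at h2
  linarith

theorem aux_key {n : ℕ} (γ μ : ℝ) (hγ : 0 < γ)
    (Cbar T : Matrix (Fin n) (Fin n) ℝ) (hCbar : Cbar.IsSymm)
    (lam : Fin n → ℝ) (U : Matrix (Fin n) (Fin n) ℝ) (hU : IsOrth U)
    (hdec : Cbar + γ • T = U * Matrix.diagonal lam * Uᵀ) (d : Fin n → ℝ)
    (hd : ∀ i, 0 < d i) (hq : ∀ i, d i - γ * (d i)⁻¹ = lam i - γ * μ)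
    (P : Matrix (Fin n) (Fin n) ℝ) (hP : P = U * Matrix.diagonal d * Uᵀ)
    (C : Matrix (Fin n) (Fin n) ℝ) (hC : C.PosDef) :
    (γ * (-Real.log P.det - (T * P).trace + μ * P.trace) + frobSq (P - Cbar) / 2)
      + frobSq (C - P) / 2 ≤
    (γ * (-Real.log C.det - (T * C).trace + μ * C.trace) + frobSq (C - Cbar) / 2) := by
  have hUU : U * Uᵀ = 1 := mul_eq_one_comm.mp hU
  have hlog := aux_log U hU d hd C hC
  rw [← hP] at hlog
  set Q := U * Matrix.diagonal (fun i => (d i)⁻¹) * Uᵀ with hQ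
  have hPt : Pᵀ = P := by
    rw [hP]; simp [Matrix.transpose_mul, Matrix.mul_assoc]
  have hQP : Q * P = 1 := by
    have : Q * P = U * (Matrix.diagonal (fun i => (d i)⁻¹) * ((Uᵀ * U) * Matrix.diagonal d)) * Uᵀ := by
      rw [hQ, hP]; simp only [Matrix.mul_assoc]
    rw [this, show Uᵀ * U = 1 from hU, Matrix.one_mul, Matrix.diagonal_mul_diagonal]
    simp [fun i => inv_mul_cancel₀ (hd i).ne', hUU]
  have hrel : P - Cbar = γ • Q + γ • T - (γ * μ) • (1 : Matrix (Fin n) (Fin n) ℝ) := by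
    have e : Matrix.diagonal d = γ • Matrix.diagonal (fun i => (d i)⁻¹) + Matrix.diagonal lam
        - (γ * μ) • (1 : Matrix (Fin n) (Fin n) ℝ) := by
      ext i j
      by_cases hij : i = j
      · subst hij
        have := hq i
        simp
        linarith
      · simp [hij]
    have e2 : P = γ • Q + (Cbar + γ • T) - (γ * μ) • (1 : Matrix (Fin n) (Fin n) ℝ) := by
      rw [hdec, hP, e, hQ]
      simp [Matrix.mul_add, Matrix.add_mul, Matrix.mul_sub, Matrix.sub_mul, hUU]
    rw [eq_sub_iff_add_eq] at e2
    rw [eq_sub_iff_add_eq, sub_add_eq_add_sub, e2]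
    abel
  have hf := aux_frob C Cbar P
  rw [Matrix.transpose_sub, hPt, hCbar.eq, hrel] at hf
  rw [← hrel] at hf
  have ht : ((P - Cbar) * (C - P)).trace = γ * (Q * C).trace - γ * n + γ * (T * C).trace
      - γ * (T * P).trace - γ * μ * C.trace + γ * μ * P.trace := by
    rw [hrel]
    simp only [Matrix.mul_sub, Matrix.add_mul, Matrix.sub_mul, Matrix.smul_mul, Matrix.one_mul,
      hQP, Matrix.trace_sub, Matrix.trace_add, Matrix.trace_smul, Matrix.trace_one, smul_eq_mul,
      Fintype.card_fin]
    ring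
  rw [ht] at hf
  have := mul_le_mul_of_nonneg_left hlog hγ.le
  linarith

/-- The objective `C ↦ γ(−log det C − tr(TC) + μ tr C) + ½‖C − C̄‖_F²` (with
value `+∞` off the positive definite cone) has the unique minimizer
`U Diag(½(λᵢ − γμ + √((λᵢ − γμ)² + 4γ))) Uᵀ` over symmetric matrices, where
`C̄ + γT = U Diag(λ) Uᵀ` with `U` orthogonal. -/
theorem stmt19 (n : ℕ) (hn : 0 < n) (γ μ : ℝ) (hγ : 0 < γ) (hμ : 0 < μ)
    (Cbar T : Matrix (Fin n) (Fin n) ℝ) (hCbar : Cbar.IsSymm) (hT : T.IsSymm)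
    (lam : Fin n → ℝ) (U : Matrix (Fin n) (Fin n) ℝ) (hU : IsOrth U)
    (hdec : Cbar + γ • T = U * Matrix.diagonal lam * Uᵀ) :
    (U * Matrix.diagonal
        (fun i => (lam i - γ * μ + Real.sqrt ((lam i - γ * μ) ^ 2 + 4 * γ)) / 2) * Uᵀ).IsSymm ∧
    (∀ C : Matrix (Fin n) (Fin n) ℝ, C.IsSymm →
      logdetProxObj γ μ T Cbar
          (U * Matrix.diagonal
            (fun i => (lam i - γ * μ + Real.sqrt ((lam i - γ * μ) ^ 2 + 4 * γ)) / 2) * Uᵀ)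
        ≤ logdetProxObj γ μ T Cbar C) ∧
    (∀ C : Matrix (Fin n) (Fin n) ℝ, C.IsSymm →
      (∀ C' : Matrix (Fin n) (Fin n) ℝ, C'.IsSymm →
        logdetProxObj γ μ T Cbar C ≤ logdetProxObj γ μ T Cbar C') →
      C = U * Matrix.diagonal
        (fun i => (lam i - γ * μ + Real.sqrt ((lam i - γ * μ) ^ 2 + 4 * γ)) / 2) * Uᵀ) := by
  set d : Fin n → ℝ :=
    (fun i => (lam i - γ * μ + Real.sqrt ((lam i - γ * μ) ^ 2 + 4 * γ)) / 2) with hd_def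
  have hd : ∀ i, 0 < d i := by
    intro i
    have h : |lam i - γ * μ| < Real.sqrt ((lam i - γ * μ) ^ 2 + 4 * γ) := by
      rw [← Real.sqrt_sq_eq_abs]
      exact Real.sqrt_lt_sqrt (sq_nonneg _) (by linarith)
    have := neg_abs_le (lam i - γ * μ)
    simp only [hd_def]
    linarith
  have hq : ∀ i, d i - γ * (d i)⁻¹ = lam i - γ * μ := by
    intro i
    have h := Real.sq_sqrt (show 0 ≤ (lam i - γ * μ) ^ 2 + 4 * γ by positivity)
    have h2 : d i * d i - γ = (lam i - γ * μ) * d i := by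
      simp only [hd_def]
      linear_combination h / 4
    have := (hd i).ne'
    field_simp
    linarith
  have hPpd := aux_posdef U hU d hd
  set P := U * Matrix.diagonal d * Uᵀ with hP
  have hkey := aux_key γ μ hγ Cbar T hCbar lam U hU hdec d hd hq P hP
  have hPs : P.IsSymm := by
    have := hPpd.isHermitian.eq
    rwa [Matrix.conjTranspose_eq_transpose_of_trivial] at this
  refine ⟨hPs, fun C _ => ?_, fun C _ hmin => ?_⟩
  · by_cases hC : C.PosDef
    · simp only [logdetProxObj, if_pos hPpd, if_pos hC]
      have := hkey C hC
      have := aux_frob_nonneg (C - P)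
      exact EReal.coe_le_coe_iff.mpr (by linarith)
    · simp [logdetProxObj, if_neg hC]
  · have h := hmin P hPs
    by_cases hC : C.PosDef
    · simp only [logdetProxObj, if_pos hPpd, if_pos hC] at h
      have h' := EReal.coe_le_coe_iff.mp h
      have := hkey C hC
      exact sub_eq_zero.mp (aux_frob_zero _ (by linarith))
    · simp only [logdetProxObj, if_pos hPpd, if_neg hC] at h
      exact absurd (top_le_iff.mp h) (EReal.coe_ne_top _)
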